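/- Let 1 < α < 2, let β satisfy α-1 ≤ β ≤ 1, set λ_n := [sin(πα)/(sin(π(α-β)) + sin(πβ))]·Γ(n+α)/n!, let f : (0,1) → ℝ satisfy ∫₀¹ ρ^{(β-1,α-β-1)} f² < ∞, and define f_i := ∫₀¹ ρ^{(β-1,α-β-1)}(x) f(x) G_i^{(β-1,α-β-1)}(x) dx and c_i := f_{i+1}/(λ_i·|‖G_{i+1}^{(β-1,α-β-1)}‖|²) for i ≥ 0. Then for all integers M > N ≥ 0, the unweighted L² bound ∫₀¹ ( ρ^{(α-β,β)}(x) Σ_{i=N}^{M-1} c_i G_i^{(α-β,β)}(x) )² dx ≤ (1/λ_N²) ∫₀¹ ρ^{(β-1,α-β-1)}(x) f(x)² dx holds, and there is a constant C > 0 depending only on α and β with (1/λ_N²) ≤ C (N+1)^{-2(α-1)}. -/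

import Mathlib

open Real MeasureTheory

/-- Jacobi polynomial `P_n^{(a,b)}(x)`. -/
noncomputable def jacobiP (a b : ℝ) (n : ℕ) (x : ℝ) : ℝ :=
  ∑ m ∈ Finset.range (n + 1),
    (1 / 2 ^ n : ℝ) *
      (Real.Gamma ((n : ℝ) + a + 1) /
        (Real.Gamma ((m : ℝ) + 1) * Real.Gamma ((n : ℝ) + a - (m : ℝ) + 1))) *
      (Real.Gamma ((n : ℝ) + b + 1) /
        (Real.Gamma ((n : ℝ) - (m : ℝ) + 1) * Real.Gamma (b + (m : ℝ) + 1))) *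
      (x - 1) ^ (n - m) * (x + 1) ^ m

/-- Shifted Jacobi polynomial `G_n^{(a,b)}(t) = P_n^{(a,b)}(2t-1)`. -/
noncomputable def jacobiG (a b : ℝ) (n : ℕ) (t : ℝ) : ℝ :=
  jacobiP a b n (2 * t - 1)

/-- Square of the norm constant `|‖G_n^{(a,b)}‖|`. -/
noncomputable def Gnorm2 (a b : ℝ) (n : ℕ) : ℝ :=
  Real.Gamma ((n : ℝ) + a + 1) * Real.Gamma ((n : ℝ) + b + 1) /
    ((2 * (n : ℝ) + a + b + 1) * Real.Gamma ((n : ℝ) + 1) * Real.Gamma ((n : ℝ) + a + b + 1))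

/-- The weight function `ρ^{(a,b)}(x) = (1-x)^a x^b`. -/
noncomputable def rho (a b x : ℝ) : ℝ := (1 - x) ^ a * x ^ b

/-- The eigenvalue `λ_n = [sin(πα)/(sin(π(α-β))+sin(πβ))]·Γ(n+α)/n!`. -/
noncomputable def lamda (α β : ℝ) (n : ℕ) : ℝ :=
  Real.sin (π * α) / (Real.sin (π * (α - β)) + Real.sin (π * β)) *
    (Real.Gamma ((n : ℝ) + α) / (n.factorial : ℝ))

theorem Gamma_add_natCast_eq_ascPochhammer {x : ℝ} (hx : 0 < x) (k : ℕ) :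
    Real.Gamma (x + k) = (ascPochhammer ℝ k).eval x * Real.Gamma x := by
  induction k with
  | zero => simp
  | succ k ih =>
    rw [ascPochhammer_succ_eval, Nat.cast_succ, ← add_assoc,
      Real.Gamma_add_one (by positivity), ih]
    ring

theorem ringChoose_eq_Gamma {r : ℝ} {m : ℕ} (h : 0 < r - m + 1) :
    Ring.choose r m =
      Real.Gamma (r + 1) / (Real.Gamma ((m : ℝ) + 1) * Real.Gamma (r - m + 1)) := by
  have h1 := Gamma_add_natCast_eq_ascPochhammer h m
  have h2 := Ring.descPochhammer_eq_factorial_smul_choose r m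
  rw [← Polynomial.aeval_eq_smeval, Polynomial.aeval_def, ← Polynomial.eval_map,
    descPochhammer_map, descPochhammer_eval_eq_ascPochhammer, nsmul_eq_mul] at h2
  rw [show r - m + 1 + m = r + 1 by ring, h2] at h1
  have := Real.Gamma_pos_of_pos h
  rw [Real.Gamma_nat_eq_factorial, h1]
  field_simp

/-- The beta integral in terms of the weight `rho`. -/
theorem integral_rho {a b : ℝ} (ha : -1 < a) (hb : -1 < b) :
    IntegrableOn (rho a b) (Set.Ioo 0 1) ∧
      ∫ x in Set.Ioo (0:ℝ) 1, rho a b x =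
        Real.Gamma (a + 1) * Real.Gamma (b + 1) / Real.Gamma (a + b + 2) := by
  have hconv := Complex.betaIntegral_convergent (u := ((b + 1 : ℝ) : ℂ)) (v := ((a + 1 : ℝ) : ℂ))
    (by simp; linarith) (by simp; linarith)
  rw [intervalIntegrable_iff_integrableOn_Ioo_of_le zero_le_one] at hconv
  have hcongr : ∀ x ∈ Set.Ioo (0:ℝ) 1,
      RCLike.re ((x : ℂ) ^ (((b + 1 : ℝ) : ℂ) - 1) * (1 - (x : ℂ)) ^ (((a + 1 : ℝ) : ℂ) - 1))
        = rho a b x := by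
    intro x hx
    have h1 : (((b + 1 : ℝ) : ℂ) - 1) = ((b : ℝ) : ℂ) := by push_cast; ring
    have h2 : (((a + 1 : ℝ) : ℂ) - 1) = ((a : ℝ) : ℂ) := by push_cast; ring
    have h3 : (1 - (x : ℂ)) = ((1 - x : ℝ) : ℂ) := by push_cast; ring
    rw [h1, h2, h3, ← Complex.ofReal_cpow hx.1.le, ← Complex.ofReal_cpow (by linarith [hx.2]),
      ← Complex.ofReal_mul, RCLike.re_to_complex, Complex.ofReal_re, rho, mul_comm]
  refine ⟨IntegrableOn.congr_fun (Integrable.re hconv) hcongr measurableSet_Ioo, ?_⟩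
  have h := ProbabilityTheory.beta_eq_betaIntegralReal (b + 1) (a + 1) (by linarith) (by linarith)
  rw [Complex.betaIntegral, intervalIntegral.integral_of_le zero_le_one,
    integral_Ioc_eq_integral_Ioo, ← RCLike.re_to_complex, ← integral_re hconv,
    setIntegral_congr_fun measurableSet_Ioo hcongr] at h
  rw [← h, ProbabilityTheory.beta, show b + 1 + (a + 1) = a + b + 2 by ring, mul_comm]

theorem integrableOn_rho_mul {a b : ℝ} (ha : -1 < a) (hb : -1 < b) {g : ℝ → ℝ}
    (hg : Continuous g) : IntegrableOn (fun x => rho a b x * g x) (Set.Ioo 0 1) := by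
  have h := (integral_rho ha hb).1
  rw [← intervalIntegrable_iff_integrableOn_Ioo_of_le zero_le_one] at h ⊢
  exact h.mul_continuousOn hg.continuousOn

theorem rho_mul_pow {a b x : ℝ} (hx : x ∈ Set.Ioo (0:ℝ) 1) (j k : ℕ) :
    rho a b x * ((1 - x) ^ j * x ^ k) = rho (a + j) (b + k) x := by
  rw [rho, rho, Real.rpow_add_natCast (by linarith [hx.2]), Real.rpow_add_natCast hx.1.ne']
  ring

/-- Coefficient of `(t-1)^(n-m) t^m` in the shifted Jacobi polynomial. -/
noncomputable def jacobiCoeff (a b : ℝ) (n m : ℕ) : ℝ :=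
  Real.Gamma ((n : ℝ) + a + 1) /
      (Real.Gamma ((m : ℝ) + 1) * Real.Gamma ((n : ℝ) + a - (m : ℝ) + 1)) *
    (Real.Gamma ((n : ℝ) + b + 1) /
      (Real.Gamma ((n : ℝ) - (m : ℝ) + 1) * Real.Gamma (b + (m : ℝ) + 1)))

/-- The shifted Jacobi polynomial as an element of `ℝ[X]`. -/
noncomputable def jacobiPoly (a b : ℝ) (n : ℕ) : Polynomial ℝ :=
  ∑ m ∈ Finset.range (n + 1), Polynomial.C (jacobiCoeff a b n m) *
    ((Polynomial.X - Polynomial.C 1) ^ (n - m) * Polynomial.X ^ m)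

theorem eval_jacobiPoly (a b : ℝ) (n : ℕ) (t : ℝ) :
    (jacobiPoly a b n).eval t = jacobiG a b n t := by
  rw [jacobiPoly, jacobiG, jacobiP, Polynomial.eval_finsetSum]
  refine Finset.sum_congr rfl fun m hm => ?_
  have hm : m ≤ n := by simpa [Nat.lt_succ_iff] using hm
  simp only [Polynomial.eval_mul, Polynomial.eval_C, Polynomial.eval_pow, Polynomial.eval_sub,
    Polynomial.eval_X, jacobiCoeff]
  rw [show 2 * t - 1 - 1 = 2 * (t - 1) by ring, show 2 * t - 1 + 1 = 2 * t by ring, mul_pow,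
    mul_pow]
  have : (2 : ℝ) ^ n = 2 ^ (n - m) * 2 ^ m := by rw [← pow_add, Nat.sub_add_cancel hm]
  rw [this]
  field_simp

theorem continuous_jacobiG (a b : ℝ) (n : ℕ) : Continuous (jacobiG a b n) := by
  rw [← funext (eval_jacobiPoly a b n)]
  exact (jacobiPoly a b n).continuous

theorem monic_jacobi_factor {n m : ℕ} :
    ((Polynomial.X - Polynomial.C (1:ℝ)) ^ (n - m) * Polynomial.X ^ m).Monic :=
  ((Polynomial.monic_X_sub_C 1).pow _).mul (Polynomial.monic_X_pow m)

theorem natDegree_jacobi_factor {n m : ℕ} (hm : m ≤ n) :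
    ((Polynomial.X - Polynomial.C (1:ℝ)) ^ (n - m) * Polynomial.X ^ m).natDegree = n := by
  rw [((Polynomial.monic_X_sub_C (1:ℝ)).pow _).natDegree_mul (Polynomial.monic_X_pow m),
    (Polynomial.monic_X_sub_C (1:ℝ)).natDegree_pow, Polynomial.natDegree_X_sub_C,
    Polynomial.natDegree_X_pow]
  omega

theorem natDegree_jacobiPoly_le (a b : ℝ) (n : ℕ) : (jacobiPoly a b n).natDegree ≤ n := by
  refine Polynomial.natDegree_sum_le_of_forall_le _ _ fun m hm => ?_
  have hm : m ≤ n := by simpa [Nat.lt_succ_iff] using hm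
  exact (Polynomial.natDegree_C_mul_le _ _).trans (natDegree_jacobi_factor hm).le

theorem coeff_jacobiPoly {a b : ℝ} (ha : -1 < a) (hb : -1 < b) (hab : -1 < a + b) (n : ℕ) :
    (jacobiPoly a b n).coeff n = Real.Gamma (2 * n + a + b + 1) /
      (Real.Gamma ((n : ℝ) + 1) * Real.Gamma (n + a + b + 1)) := by
  have hc : ∀ m ∈ Finset.range (n + 1), (Polynomial.C (jacobiCoeff a b n m) *
      ((Polynomial.X - Polynomial.C 1) ^ (n - m) * Polynomial.X ^ m)).coeff n =
        Ring.choose ((n:ℝ) + a) m * Ring.choose ((n:ℝ) + b) (n - m) := by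
    intro m hm
    have hm : m ≤ n := by simpa [Nat.lt_succ_iff] using hm
    have hmr : (m : ℝ) ≤ n := by exact_mod_cast hm
    have hcast : ((n - m : ℕ) : ℝ) = n - m := Nat.cast_sub hm
    have h0 : (0:ℝ) ≤ m := m.cast_nonneg
    have hlead := (monic_jacobi_factor (n := n) (m := m)).coeff_natDegree
    rw [natDegree_jacobi_factor hm] at hlead
    rw [Polynomial.coeff_C_mul, hlead, mul_one, ringChoose_eq_Gamma (by linarith),
      ringChoose_eq_Gamma (by rw [hcast]; linarith), hcast, jacobiCoeff,
      show (n:ℝ) + b - (n - m) + 1 = b + m + 1 by ring]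
  rw [jacobiPoly, Polynomial.finsetSum_coeff, Finset.sum_congr rfl hc,
    ← Finset.Nat.sum_antidiagonal_eq_sum_range_succ
      (fun i j => Ring.choose ((n:ℝ) + a) i * Ring.choose ((n:ℝ) + b) j),
    ← Ring.add_choose_eq n (Commute.all _ _),
    ringChoose_eq_Gamma (by linarith [n.cast_nonneg (α := ℝ)])]
  congr 2
  · ring
  · congr 1; ring

theorem sum_alternating_choose_mul_ascPochhammer (y : ℝ) {n k : ℕ} (hk : k ≤ n) :
    ∑ m ∈ Finset.range (n + 1), (-1 : ℝ) ^ (n - m) * n.choose m *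
      (ascPochhammer ℝ k).eval (y + m) = if k = n then (n.factorial : ℝ) else 0 := by
  have h := fwdDiff_iter_eq_sum_shift (1 : ℝ) (ascPochhammer ℝ k).eval n y
  have h' : (fwdDiff (1:ℝ))^[n] (ascPochhammer ℝ k).eval y =
      if k = n then (n.factorial : ℝ) else 0 := by
    split_ifs with hkn
    · subst hkn
      have := congrFun (Polynomial.fwdDiff_iter_degree_eq_factorial (ascPochhammer ℝ k)) y
      rw [ascPochhammer_natDegree, (monic_ascPochhammer ℝ k).leadingCoeff] at this
      simpa using this
    · rw [Polynomial.fwdDiff_iter_eq_zero_of_degree_lt]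
      · rfl
      · rw [ascPochhammer_natDegree]; omega
  rw [← h', h]
  refine Finset.sum_congr rfl fun m _ => ?_
  simp

theorem integral_rho_mul_jacobiG_mul_pow {a b : ℝ} (ha : -1 < a) (hb : -1 < b) {n k : ℕ}
    (hk : k ≤ n) :
    ∫ x in Set.Ioo (0:ℝ) 1, rho a b x * (jacobiG a b n x * x ^ k) =
      if k = n then Real.Gamma (n + a + 1) * Real.Gamma (n + b + 1) /
        Real.Gamma (2 * n + a + b + 2) else 0 := by
  have hterm : ∀ m ∈ Finset.range (n + 1),
      ∫ x in Set.Ioo (0:ℝ) 1,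
        rho a b x * (jacobiCoeff a b n m * ((x - 1) ^ (n - m) * x ^ m) * x ^ k) =
      Real.Gamma (n + a + 1) * Real.Gamma (n + b + 1) /
        (n.factorial * Real.Gamma (n + k + a + b + 2)) *
        ((-1 : ℝ) ^ (n - m) * n.choose m * (ascPochhammer ℝ k).eval (b + 1 + m)) := by
    intro m hm
    have hm : m ≤ n := by simpa [Nat.lt_succ_iff] using hm
    have hmr : (m : ℝ) ≤ n := by exact_mod_cast hm
    have hcast : ((n - m : ℕ) : ℝ) = n - m := Nat.cast_sub hm
    have h0 : (0:ℝ) ≤ m := m.cast_nonneg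
    have hk0 : (0:ℝ) ≤ k := k.cast_nonneg
    have hI := (integral_rho (a := a + (n - m : ℕ)) (b := b + (m + k : ℕ))
      (by rw [hcast]; linarith) (by push_cast; linarith)).2
    have hcg : ∀ x ∈ Set.Ioo (0:ℝ) 1,
        rho a b x * (jacobiCoeff a b n m * ((x - 1) ^ (n - m) * x ^ m) * x ^ k) =
        (jacobiCoeff a b n m * (-1) ^ (n - m)) *
          rho (a + (n - m : ℕ)) (b + (m + k : ℕ)) x := by
      intro x hx
      rw [← rho_mul_pow hx, show x - 1 = (-1) * (1 - x) by ring, mul_pow]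
      ring
    rw [setIntegral_congr_fun measurableSet_Ioo hcg, integral_const_mul, hI, jacobiCoeff]
    have hG := Gamma_add_natCast_eq_ascPochhammer (x := b + 1 + m) (by linarith) k
    have hch : (n.choose m : ℝ) = n.factorial / (m.factorial * (n - m).factorial) := by
      rw [Nat.cast_choose ℝ hm]
    have hf1 : Real.Gamma ((m : ℝ) + 1) = m.factorial := Real.Gamma_nat_eq_factorial m
    have hf2 : Real.Gamma ((n : ℝ) - m + 1) = (n - m).factorial := by
      rw [← hcast, Real.Gamma_nat_eq_factorial]
    have hp1 := Real.Gamma_pos_of_pos (show 0 < (n:ℝ) + a - m + 1 by linarith)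
    have hp2 := Real.Gamma_pos_of_pos (show 0 < b + 1 + (m:ℝ) by linarith)
    have hp3 := Real.Gamma_pos_of_pos (show 0 < (n:ℝ) + k + a + b + 2 by linarith)
    have e1 : a + ((n - m : ℕ) : ℝ) + 1 = n + a - m + 1 := by rw [hcast]; ring
    have e2 : b + ((m + k : ℕ) : ℝ) + 1 = b + 1 + m + k := by push_cast; ring
    have e3 : a + ((n - m : ℕ) : ℝ) + (b + ((m + k : ℕ) : ℝ)) + 2 = n + k + a + b + 2 := by
      rw [hcast]; push_cast; ring
    rw [e1, e2, e3, hG, hch, hf1, hf2, show b + (m:ℝ) + 1 = b + 1 + m by ring]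
    field_simp
  have hexp : ∀ x, rho a b x * (jacobiG a b n x * x ^ k) = ∑ m ∈ Finset.range (n + 1),
      rho a b x * (jacobiCoeff a b n m * ((x - 1) ^ (n - m) * x ^ m) * x ^ k) := by
    intro x
    rw [← eval_jacobiPoly, jacobiPoly, Polynomial.eval_finsetSum, Finset.sum_mul, Finset.mul_sum]
    simp
  simp_rw [hexp]
  rw [integral_finsetSum _ fun m _ => integrableOn_rho_mul ha hb (by fun_prop),
    Finset.sum_congr rfl hterm, ← Finset.mul_sum, sum_alternating_choose_mul_ascPochhammer _ hk]
  split_ifs with h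
  · subst h
    have : (k.factorial : ℝ) ≠ 0 := by exact_mod_cast k.factorial_ne_zero
    rw [show (k:ℝ) + k + a + b + 2 = 2 * k + a + b + 2 by ring]
    field_simp
  · simp

theorem integral_rho_mul_jacobiG_mul_eval {a b : ℝ} (ha : -1 < a) (hb : -1 < b) {n : ℕ}
    {p : Polynomial ℝ} (hp : p.natDegree ≤ n) :
    ∫ x in Set.Ioo (0:ℝ) 1, rho a b x * (jacobiG a b n x * p.eval x) =
      p.coeff n * (Real.Gamma (n + a + 1) * Real.Gamma (n + b + 1) /
        Real.Gamma (2 * n + a + b + 2)) := by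
  have hexp : ∀ x, rho a b x * (jacobiG a b n x * p.eval x) = ∑ k ∈ Finset.range (n + 1),
      p.coeff k * (rho a b x * (jacobiG a b n x * x ^ k)) := by
    intro x
    rw [Polynomial.eval_eq_sum_range' (Nat.lt_succ_of_le hp), Finset.mul_sum, Finset.mul_sum]
    exact Finset.sum_congr rfl fun k _ => by ring
  have hcont := continuous_jacobiG a b n
  simp_rw [hexp]
  rw [integral_finsetSum _ fun k _ =>
    (integrableOn_rho_mul (g := fun x => jacobiG a b n x * x ^ k) ha hb
      (hcont.mul (continuous_pow k))).const_mul _]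
  simp_rw [integral_const_mul]
  rw [Finset.sum_range_succ, integral_rho_mul_jacobiG_mul_pow ha hb le_rfl, if_pos rfl,
    Finset.sum_eq_zero, zero_add]
  intro k hk
  have hk := Finset.mem_range.1 hk
  rw [integral_rho_mul_jacobiG_mul_pow ha hb hk.le, if_neg hk.ne, mul_zero]

theorem Gnorm2_pos {a b : ℝ} (ha : -1 < a) (hb : -1 < b) (hab : -1 < a + b) (n : ℕ) :
    0 < Gnorm2 a b n := by
  have h0 : (0:ℝ) ≤ n := n.cast_nonneg
  have h1 := Real.Gamma_pos_of_pos (show 0 < (n:ℝ) + a + 1 by linarith)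
  have h2 := Real.Gamma_pos_of_pos (show 0 < (n:ℝ) + b + 1 by linarith)
  have h3 := Real.Gamma_pos_of_pos (show 0 < (n:ℝ) + 1 by linarith)
  have h4 := Real.Gamma_pos_of_pos (show 0 < (n:ℝ) + a + b + 1 by linarith)
  have h5 : 0 < 2 * (n:ℝ) + a + b + 1 := by linarith
  rw [Gnorm2]
  positivity

/-- Orthogonality of the shifted Jacobi polynomials. -/
theorem integral_rho_mul_jacobiG_mul_jacobiG {a b : ℝ} (ha : -1 < a) (hb : -1 < b)
    (hab : -1 < a + b) (i j : ℕ) :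
    ∫ x in Set.Ioo (0:ℝ) 1, rho a b x * (jacobiG a b i x * jacobiG a b j x) =
      if i = j then Gnorm2 a b i else 0 := by
  have hlt : ∀ i j : ℕ, j < i →
      ∫ x in Set.Ioo (0:ℝ) 1, rho a b x * (jacobiG a b i x * jacobiG a b j x) = 0 := by
    intro i j hij
    have hd := (natDegree_jacobiPoly_le a b j).trans_lt hij
    simp_rw [← eval_jacobiPoly a b j]
    rw [integral_rho_mul_jacobiG_mul_eval ha hb hd.le,
      Polynomial.coeff_eq_zero_of_natDegree_lt hd, zero_mul]
  rcases lt_trichotomy i j with h | rfl | h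
  · simp_rw [mul_comm (jacobiG a b i _)]
    rw [hlt j i h, if_neg h.ne]
  · rw [if_pos rfl]
    have h0 : (0:ℝ) ≤ i := i.cast_nonneg
    have h := integral_rho_mul_jacobiG_mul_eval ha hb (natDegree_jacobiPoly_le a b i)
    simp_rw [eval_jacobiPoly] at h
    have h5 : 0 < 2 * (i:ℝ) + a + b + 1 := by linarith
    have h6 := Real.Gamma_pos_of_pos h5
    have h4 := Real.Gamma_pos_of_pos (show 0 < (i:ℝ) + a + b + 1 by linarith)
    have h3 := Real.Gamma_pos_of_pos (show 0 < (i:ℝ) + 1 by linarith)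
    rw [h, coeff_jacobiPoly ha hb hab, Gnorm2,
      show 2 * (i:ℝ) + a + b + 2 = 2 * i + a + b + 1 + 1 by ring, Real.Gamma_add_one h5.ne']
    field_simp
  · rw [hlt i j h, if_neg h.ne']

theorem jacobiPoly_ne_zero {a b : ℝ} (ha : -1 < a) (hb : -1 < b) (hab : -1 < a + b) (n : ℕ) :
    jacobiPoly a b n ≠ 0 := by
  intro h
  have h0 : (0:ℝ) ≤ n := n.cast_nonneg
  have hc := coeff_jacobiPoly ha hb hab n
  have h6 := Real.Gamma_pos_of_pos (show 0 < 2 * (n:ℝ) + a + b + 1 by linarith)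
  have h4 := Real.Gamma_pos_of_pos (show 0 < (n:ℝ) + a + b + 1 by linarith)
  have h3 := Real.Gamma_pos_of_pos (show 0 < (n:ℝ) + 1 by linarith)
  have : 0 < Real.Gamma (2 * n + a + b + 1) /
      (Real.Gamma ((n : ℝ) + 1) * Real.Gamma (n + a + b + 1)) := by positivity
  rw [h, Polynomial.coeff_zero] at hc
  linarith

section WeightedOrthogonal

variable {μ : Measure ℝ} {w f : ℝ → ℝ} {φ : ℕ → ℝ → ℝ} {g : ℕ → ℝ}

theorem weight_mul_sum_sq (d : ℕ → ℝ) (s : Finset ℕ) (x : ℝ) :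
    w x * (∑ i ∈ s, d i * φ i x) ^ 2 =
      ∑ i ∈ s, ∑ j ∈ s, d i * d j * (w x * (φ i x * φ j x)) := by
  rw [sq, Finset.sum_mul_sum, Finset.mul_sum]
  refine Finset.sum_congr rfl fun i _ => ?_
  rw [Finset.mul_sum]
  exact Finset.sum_congr rfl fun j _ => by ring

theorem integrable_weight_mul_sum_sq
    (hφ : ∀ i j, Integrable (fun x => w x * (φ i x * φ j x)) μ) (d : ℕ → ℝ) (s : Finset ℕ) :
    Integrable (fun x => w x * (∑ i ∈ s, d i * φ i x) ^ 2) μ := by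
  simp_rw [weight_mul_sum_sq]
  exact integrable_finsetSum _ fun i _ => integrable_finsetSum _ fun j _ => (hφ i j).const_mul _

/-- Parseval's identity for a finite sum of functions orthogonal with respect to a weight. -/
theorem integral_weight_mul_sum_sq
    (hφ : ∀ i j, Integrable (fun x => w x * (φ i x * φ j x)) μ)
    (horth : ∀ i j, ∫ x, w x * (φ i x * φ j x) ∂μ = if i = j then g i else 0)
    (d : ℕ → ℝ) (s : Finset ℕ) :
    ∫ x, w x * (∑ i ∈ s, d i * φ i x) ^ 2 ∂μ = ∑ i ∈ s, d i ^ 2 * g i := by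
  simp_rw [weight_mul_sum_sq]
  rw [integral_finsetSum _ fun i _ => integrable_finsetSum _ fun j _ => (hφ i j).const_mul _]
  refine Finset.sum_congr rfl fun i hi => ?_
  rw [integral_finsetSum _ fun j _ => (hφ i j).const_mul _]
  simp_rw [integral_const_mul, horth, mul_ite, mul_zero]
  rw [Finset.sum_ite_eq, if_pos hi, sq]

/-- Bessel's inequality with respect to a weight. -/
theorem sum_sq_div_le_integral_weight_mul_sq (hw : ∀ᵐ x ∂μ, 0 ≤ w x)
    (hf : Integrable (fun x => w x * f x ^ 2) μ)
    (hfφ : ∀ i, Integrable (fun x => w x * f x * φ i x) μ)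
    (hφ : ∀ i j, Integrable (fun x => w x * (φ i x * φ j x)) μ)
    (horth : ∀ i j, ∫ x, w x * (φ i x * φ j x) ∂μ = if i = j then g i else 0)
    (s : Finset ℕ) (hg : ∀ i ∈ s, g i ≠ 0) :
    ∑ i ∈ s, (∫ x, w x * f x * φ i x ∂μ) ^ 2 / g i ≤ ∫ x, w x * f x ^ 2 ∂μ := by
  set F : ℕ → ℝ := fun i => ∫ x, w x * f x * φ i x ∂μ
  set d : ℕ → ℝ := fun i => F i / g i with hd
  have hcross : Integrable (fun x => ∑ i ∈ s, 2 * d i * (w x * f x * φ i x)) μ :=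
    integrable_finsetSum _ fun i _ => (hfφ i).const_mul _
  have hdiff : Integrable
      (fun x => w x * f x ^ 2 - ∑ i ∈ s, 2 * d i * (w x * f x * φ i x)) μ := hf.sub hcross
  have hexp : ∀ x, w x * (f x - ∑ i ∈ s, d i * φ i x) ^ 2 =
      w x * f x ^ 2 - ∑ i ∈ s, 2 * d i * (w x * f x * φ i x) +
        w x * (∑ i ∈ s, d i * φ i x) ^ 2 := by
    intro x
    have : ∑ i ∈ s, 2 * d i * (w x * f x * φ i x) =
        2 * (w x * f x) * ∑ i ∈ s, d i * φ i x := by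
      rw [Finset.mul_sum]
      exact Finset.sum_congr rfl fun i _ => by ring
    rw [this]
    ring
  have hnn : 0 ≤ ∫ x, w x * (f x - ∑ i ∈ s, d i * φ i x) ^ 2 ∂μ :=
    integral_nonneg_of_ae (hw.mono fun x hx => mul_nonneg hx (sq_nonneg _))
  simp_rw [hexp] at hnn
  rw [integral_add hdiff (integrable_weight_mul_sum_sq hφ d s), integral_sub hf hcross,
    integral_weight_mul_sum_sq hφ horth, integral_finsetSum _ fun i _ => (hfφ i).const_mul _] at hnn
  simp_rw [integral_const_mul] at hnn
  have h1 : ∑ i ∈ s, 2 * d i * F i = 2 * ∑ i ∈ s, F i ^ 2 / g i := by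
    rw [Finset.mul_sum]
    exact Finset.sum_congr rfl fun i _ => by simp only [hd]; ring
  have h2 : ∑ i ∈ s, d i ^ 2 * g i = ∑ i ∈ s, F i ^ 2 / g i :=
    Finset.sum_congr rfl fun i hi => by
      have := hg i hi
      simp only [hd]
      field_simp
  rw [h1, h2] at hnn
  linarith

end WeightedOrthogonal

theorem rho_pos {a b x : ℝ} (hx : x ∈ Set.Ioo (0:ℝ) 1) : 0 < rho a b x :=
  mul_pos (Real.rpow_pos_of_pos (by linarith [hx.2]) _) (Real.rpow_pos_of_pos hx.1 _)

theorem rho_le_one {a b x : ℝ} (ha : 0 ≤ a) (hb : 0 ≤ b) (hx : x ∈ Set.Ioo (0:ℝ) 1) :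
    rho a b x ≤ 1 :=
  mul_le_one₀ (Real.rpow_le_one (by linarith [hx.2]) (by linarith [hx.1]) ha)
    (Real.rpow_nonneg hx.1.le _) (Real.rpow_le_one hx.1.le hx.2.le hb)

theorem measurable_rho (a b : ℝ) : Measurable (rho a b) := by
  unfold rho
  fun_prop

theorem jacobiG_ne_zero_ae {a b : ℝ} (ha : -1 < a) (hb : -1 < b) (hab : -1 < a + b) (n : ℕ) :
    ∀ᵐ x : ℝ, jacobiG a b n x ≠ 0 := by
  have hfin := Polynomial.finite_setOfPred_isRoot (jacobiPoly_ne_zero ha hb hab n)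
  have := hfin.measure_zero (volume : Measure ℝ)
  rw [ae_iff]
  convert this using 2
  ext x
  simp [Polynomial.IsRoot, eval_jacobiPoly]

/-- `f` inherits measurability from its product with the weight and a Jacobi polynomial. -/
theorem aestronglyMeasurable_of_rho_mul_mul_jacobiG {a b : ℝ} (ha : -1 < a) (hb : -1 < b)
    (hab : -1 < a + b) {f : ℝ → ℝ} {n : ℕ}
    (h : AEStronglyMeasurable (fun x => rho a b x * f x * jacobiG a b n x)
      (volume.restrict (Set.Ioo 0 1))) :
    AEStronglyMeasurable f (volume.restrict (Set.Ioo 0 1)) := by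
  have hm : Measurable (fun x => (rho a b x * jacobiG a b n x)⁻¹) :=
    ((measurable_rho a b).mul (continuous_jacobiG a b n).measurable).inv
  refine (h.mul hm.aestronglyMeasurable).congr ?_
  filter_upwards [ae_restrict_of_ae (jacobiG_ne_zero_ae ha hb hab n),
    ae_restrict_mem measurableSet_Ioo] with x hx hx'
  have := (rho_pos (a := a) (b := b) hx').ne'
  simp only [Pi.mul_apply]
  field_simp

theorem integrable_rho_mul_mul_jacobiG {a b : ℝ} (ha : -1 < a) (hb : -1 < b) {f : ℝ → ℝ}
    (hfm : AEStronglyMeasurable f (volume.restrict (Set.Ioo 0 1)))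
    (hf : IntegrableOn (fun x => rho a b x * f x ^ 2) (Set.Ioo 0 1)) (n : ℕ) :
    IntegrableOn (fun x => rho a b x * f x * jacobiG a b n x) (Set.Ioo 0 1) := by
  have hG := integrableOn_rho_mul ha hb ((continuous_jacobiG a b n).pow 2)
  refine Integrable.mono' (hf.add hG)
    (((measurable_rho a b).aestronglyMeasurable.mul hfm).mul
      (continuous_jacobiG a b n).aestronglyMeasurable) ?_
  filter_upwards [ae_restrict_mem measurableSet_Ioo] with x hx
  have hp := rho_pos (a := a) (b := b) hx
  simp only [Pi.add_apply, Pi.pow_apply]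
  rw [Real.norm_eq_abs, mul_assoc, abs_mul, abs_of_pos hp, ← mul_add]
  refine mul_le_mul_of_nonneg_left ?_ hp.le
  rw [abs_le]
  constructor <;> nlinarith [sq_nonneg (f x + jacobiG a b n x), sq_nonneg (f x - jacobiG a b n x),
    sq_nonneg (f x), sq_nonneg (jacobiG a b n x)]

theorem Gnorm2_swap_succ_le {a b : ℝ} (ha : -1 < a) (hb : -1 < b) (hab : -1 ≤ a + b) (n : ℕ) :
    Gnorm2 (b + 1) (a + 1) n ≤ Gnorm2 a b (n + 1) := by
  have h0 : (0:ℝ) ≤ n := n.cast_nonneg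
  have h1 := Real.Gamma_pos_of_pos (show 0 < (n:ℝ) + a + 2 by linarith)
  have h2 := Real.Gamma_pos_of_pos (show 0 < (n:ℝ) + b + 2 by linarith)
  have h3 := Real.Gamma_pos_of_pos (show 0 < (n:ℝ) + 1 by linarith)
  have h5 : 0 < (n:ℝ) + a + b + 2 := by linarith
  have h4 := Real.Gamma_pos_of_pos h5
  rw [Gnorm2, Gnorm2]
  push_cast
  rw [show (n:ℝ) + (b + 1) + (a + 1) + 1 = n + a + b + 2 + 1 by ring,
    show (n:ℝ) + 1 + a + b + 1 = n + a + b + 2 by ring,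
    show (n:ℝ) + 1 + a + 1 = n + a + 2 by ring, show (n:ℝ) + 1 + b + 1 = n + b + 2 by ring,
    show (n:ℝ) + (b + 1) + 1 = n + b + 2 by ring, show (n:ℝ) + (a + 1) + 1 = n + a + 2 by ring,
    show 2 * (n:ℝ) + (b + 1) + (a + 1) + 1 = 2 * n + a + b + 3 by ring,
    show 2 * ((n:ℝ) + 1) + a + b + 1 = 2 * n + a + b + 3 by ring,
    Real.Gamma_add_one h5.ne', Real.Gamma_add_one (show (n:ℝ) + 1 ≠ 0 by positivity),
    mul_comm (Real.Gamma (n + b + 2))]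
  have h6 : 0 < 2 * (n:ℝ) + a + b + 3 := by linarith
  refine div_le_div_of_nonneg_left (by positivity) (by positivity) ?_
  have : 0 < (2 * (n:ℝ) + a + b + 3) * Real.Gamma (n + 1) * Real.Gamma (n + a + b + 2) := by
    positivity
  nlinarith

section Eigenvalue

variable {α β : ℝ}

theorem lamda_prefactor_ne_zero (hα1 : 1 < α) (hα2 : α < 2) (hβ1 : α - 1 ≤ β) (hβ2 : β ≤ 1) :
    Real.sin (π * α) / (Real.sin (π * (α - β)) + Real.sin (π * β)) ≠ 0 := by
  have hπ := Real.pi_pos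
  have h1 : Real.sin (π * α) < 0 := by
    have := Real.sin_pos_of_pos_of_lt_pi (x := π * α - π) (by nlinarith) (by nlinarith)
    rw [Real.sin_sub_pi] at this
    linarith
  have h2 : 0 ≤ Real.sin (π * (α - β)) :=
    Real.sin_nonneg_of_nonneg_of_le_pi (by nlinarith) (by nlinarith)
  have h3 : 0 ≤ Real.sin (π * β) :=
    Real.sin_nonneg_of_nonneg_of_le_pi (by nlinarith) (by nlinarith)
  have h4 : 0 < Real.sin (π * (α - β)) + Real.sin (π * β) := by
    rcases hβ2.lt_or_eq with h | rfl
    · have := Real.sin_pos_of_pos_of_lt_pi (x := π * β) (by nlinarith) (by nlinarith)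
      linarith
    · have := Real.sin_pos_of_pos_of_lt_pi (x := π * (α - 1)) (by nlinarith) (by nlinarith)
      linarith
  exact div_ne_zero h1.ne h4.ne'

theorem Gamma_div_factorial_pos (hα : 0 < α) (n : ℕ) :
    0 < Real.Gamma ((n : ℝ) + α) / n.factorial :=
  div_pos (Real.Gamma_pos_of_pos (by positivity)) (by positivity)

theorem Gamma_div_factorial_succ (hα : 0 < α) (n : ℕ) :
    Real.Gamma (((n + 1 : ℕ) : ℝ) + α) / (n + 1).factorial =
      Real.Gamma ((n : ℝ) + α) / n.factorial * ((n + α) / (n + 1)) := by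
  rw [Nat.factorial_succ]
  push_cast
  rw [show (n:ℝ) + 1 + α = n + α + 1 by ring, Real.Gamma_add_one (by positivity)]
  have : (n.factorial : ℝ) ≠ 0 := by positivity
  field_simp

theorem monotone_Gamma_div_factorial (hα : 1 ≤ α) :
    Monotone fun n : ℕ => Real.Gamma ((n : ℝ) + α) / n.factorial := by
  refine monotone_nat_of_le_succ fun n => ?_
  rw [Gamma_div_factorial_succ (by linarith)]
  refine le_mul_of_one_le_right (Gamma_div_factorial_pos (by linarith) n).le ?_
  rw [one_le_div (by positivity)]
  linarith

theorem Gamma_mul_rpow_le_Gamma_div_factorial (hα1 : 1 ≤ α) (hα2 : α ≤ 2) (n : ℕ) :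
    Real.Gamma α * ((n : ℝ) + 1) ^ (α - 1) ≤ Real.Gamma ((n : ℝ) + α) / n.factorial := by
  induction n with
  | zero => simp
  | succ n ih =>
    rw [Gamma_div_factorial_succ (by linarith)]
    have hn : (0:ℝ) < (n:ℝ) + 1 := by positivity
    have hb := rpow_one_add_le_one_add_mul_self (s := 1 / ((n:ℝ) + 1))
      (by linarith [one_div_pos.2 hn]) (p := α - 1) (by linarith) (by linarith)
    have e1 : ((n + 1 : ℕ) : ℝ) + 1 = (n + 1) * (1 + 1 / ((n:ℝ) + 1)) := by
      push_cast; field_simp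
    have e2 : 1 + (α - 1) * (1 / ((n:ℝ) + 1)) = (n + α) / (n + 1) := by field_simp; ring
    rw [e1, Real.mul_rpow hn.le (by positivity), ← mul_assoc, ← e2]
    exact mul_le_mul ih hb (by positivity) (Gamma_div_factorial_pos (by linarith) n).le

theorem one_div_lamda_sq_le (hα1 : 1 < α) (hα2 : α < 2) (hβ1 : α - 1 ≤ β) (hβ2 : β ≤ 1) :
    ∃ C : ℝ, 0 < C ∧ ∀ N : ℕ,
      1 / (lamda α β N) ^ 2 ≤ C * ((N : ℝ) + 1) ^ (-2 * (α - 1)) := by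
  have hK := lamda_prefactor_ne_zero hα1 hα2 hβ1 hβ2
  set K := Real.sin (π * α) / (Real.sin (π * (α - β)) + Real.sin (π * β)) with hKdef
  have hΓ := Real.Gamma_pos_of_pos (show 0 < α by linarith)
  have hK2 : 0 < K ^ 2 := by positivity
  refine ⟨1 / (K ^ 2 * Real.Gamma α ^ 2), by positivity, fun N => ?_⟩
  have hN : (0:ℝ) < (N:ℝ) + 1 := by positivity
  have hle := Gamma_mul_rpow_le_Gamma_div_factorial hα1.le hα2.le N
  have hr : ((N : ℝ) + 1) ^ (-2 * (α - 1)) = 1 / ((((N : ℝ) + 1) ^ (α - 1)) ^ 2) := by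
    rw [← Real.rpow_natCast, ← Real.rpow_mul hN.le, one_div, ← Real.rpow_neg hN.le]
    congr 1
    push_cast
    ring
  have hp : 0 < ((N : ℝ) + 1) ^ (α - 1) := Real.rpow_pos_of_pos hN _
  rw [hr, one_div_mul_one_div, lamda, ← hKdef, mul_pow K, mul_assoc, ← mul_pow (Real.Gamma α)]
  exact one_div_le_one_div_of_le (by positivity)
    (mul_le_mul_of_nonneg_left (pow_le_pow_left₀ (by positivity) hle 2) hK2.le)

theorem lamda_sq_pos (hα1 : 1 < α) (hα2 : α < 2) (hβ1 : α - 1 ≤ β) (hβ2 : β ≤ 1) (n : ℕ) :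
    0 < lamda α β n ^ 2 := by
  have h1 := lamda_prefactor_ne_zero hα1 hα2 hβ1 hβ2
  have h2 := Gamma_div_factorial_pos (show 0 < α by linarith) n
  rw [lamda, mul_pow]
  positivity

theorem lamda_sq_mono (hα1 : 1 < α) {m n : ℕ} (hmn : m ≤ n) :
    lamda α β m ^ 2 ≤ lamda α β n ^ 2 := by
  rw [lamda, lamda, mul_pow, mul_pow]
  have h1 := Gamma_div_factorial_pos (show 0 < α by linarith) m
  have h2 := monotone_Gamma_div_factorial hα1.le hmn
  simp only at h2
  gcongr

end Eigenvalue

/-- Bessel's inequality for Jacobi coefficients, without assuming `f` measurable. -/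
theorem sum_jacobi_coeff_sq_div_le {a b : ℝ} (ha : -1 < a) (hb : -1 < b) (hab : -1 < a + b)
    {f : ℝ → ℝ} (hf : IntegrableOn (fun x => rho a b x * f x ^ 2) (Set.Ioo 0 1))
    (s : Finset ℕ) :
    ∑ i ∈ s, (∫ x in Set.Ioo (0:ℝ) 1, rho a b x * f x * jacobiG a b i x) ^ 2 / Gnorm2 a b i ≤
      ∫ x in Set.Ioo (0:ℝ) 1, rho a b x * f x ^ 2 := by
  have hw : ∀ᵐ x ∂(volume.restrict (Set.Ioo (0:ℝ) 1)), 0 ≤ rho a b x := by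
    filter_upwards [ae_restrict_mem measurableSet_Ioo] with x hx using (rho_pos hx).le
  by_cases hfm : AEStronglyMeasurable f (volume.restrict (Set.Ioo 0 1))
  · exact sum_sq_div_le_integral_weight_mul_sq hw hf
      (integrable_rho_mul_mul_jacobiG ha hb hfm hf)
      (fun i j => integrableOn_rho_mul ha hb
        ((continuous_jacobiG a b i).mul (continuous_jacobiG a b j)))
      (integral_rho_mul_jacobiG_mul_jacobiG ha hb hab) s
      fun i _ => (Gnorm2_pos ha hb hab i).ne'
  · have hz : ∀ i, ∫ x in Set.Ioo (0:ℝ) 1, rho a b x * f x * jacobiG a b i x = 0 := fun i =>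
      integral_undef fun h =>
        hfm (aestronglyMeasurable_of_rho_mul_mul_jacobiG ha hb hab h.aestronglyMeasurable)
    simp_rw [hz]
    simpa using integral_nonneg_of_ae (hw.mono fun x hx => mul_nonneg hx (sq_nonneg (f x)))

/-- Unweighted `L²` bound for the difference of partial sums, with `1/λ_N² ≤ C(N+1)^{-2(α-1)}`. -/
theorem unweighted_L2_bound (α β : ℝ) (hα1 : 1 < α) (hα2 : α < 2)
    (hβ1 : α - 1 ≤ β) (hβ2 : β ≤ 1)
    (f : ℝ → ℝ)
    (hf : IntegrableOn (fun x => rho (β - 1) (α - β - 1) x * f x ^ 2) (Set.Ioo 0 1))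
    (fc : ℕ → ℝ)
    (hfc : ∀ i, fc i = ∫ x in (0:ℝ)..1,
        rho (β - 1) (α - β - 1) x * f x * jacobiG (β - 1) (α - β - 1) i x)
    (c : ℕ → ℝ)
    (hc : ∀ i, c i = fc (i + 1) / (lamda α β i * Gnorm2 (β - 1) (α - β - 1) (i + 1))) :
    (∀ M N : ℕ, N < M →
      (∫ x in (0:ℝ)..1,
          (rho (α - β) β x * ∑ i ∈ Finset.Ico N M, c i * jacobiG (α - β) β i x) ^ 2) ≤
        (1 / (lamda α β N) ^ 2) *
          ∫ x in (0:ℝ)..1, rho (β - 1) (α - β - 1) x * f x ^ 2) ∧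
    ∃ C : ℝ, 0 < C ∧ ∀ N : ℕ,
      1 / (lamda α β N) ^ 2 ≤ C * ((N : ℝ) + 1) ^ (-2 * (α - 1)) := by
  have ha : -1 < β - 1 := by linarith
  have hb : -1 < α - β - 1 := by linarith
  have hab : -1 < β - 1 + (α - β - 1) := by linarith
  refine ⟨fun M N _ => ?_, one_div_lamda_sq_le hα1 hα2 hβ1 hβ2⟩
  simp only [intervalIntegral.integral_of_le (zero_le_one' ℝ), integral_Ioc_eq_integral_Ioo]
    at hfc ⊢
  have hint : ∀ i j, IntegrableOn
      (fun x => rho (α - β) β x * (jacobiG (α - β) β i x * jacobiG (α - β) β j x))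
      (Set.Ioo 0 1) := fun i j => integrableOn_rho_mul (by linarith) (by linarith)
    ((continuous_jacobiG _ _ i).mul (continuous_jacobiG _ _ j))
  calc ∫ x in Set.Ioo (0:ℝ) 1,
        (rho (α - β) β x * ∑ i ∈ Finset.Ico N M, c i * jacobiG (α - β) β i x) ^ 2
      ≤ ∫ x in Set.Ioo (0:ℝ) 1,
        rho (α - β) β x * (∑ i ∈ Finset.Ico N M, c i * jacobiG (α - β) β i x) ^ 2 := by
        refine integral_mono_of_nonneg (Filter.Eventually.of_forall fun x => sq_nonneg _)
          (integrable_weight_mul_sum_sq hint c _) ?_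
        filter_upwards [ae_restrict_mem measurableSet_Ioo] with x hx
        have h0 := rho_pos (a := α - β) (b := β) hx
        have h1 := rho_le_one (a := α - β) (b := β) (by linarith) (by linarith) hx
        rw [mul_pow]
        exact mul_le_mul_of_nonneg_right (by nlinarith) (sq_nonneg _)
    _ = ∑ i ∈ Finset.Ico N M, c i ^ 2 * Gnorm2 (α - β) β i :=
        integral_weight_mul_sum_sq hint
          (integral_rho_mul_jacobiG_mul_jacobiG (by linarith) (by linarith) (by linarith)) c _
    _ ≤ ∑ i ∈ Finset.Ico N M, 1 / lamda α β N ^ 2 *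
          (fc (i + 1) ^ 2 / Gnorm2 (β - 1) (α - β - 1) (i + 1)) := by
        refine Finset.sum_le_sum fun i hi => ?_
        have hg := Gnorm2_pos ha hb hab (i + 1)
        have hle := Gnorm2_swap_succ_le ha hb hab.le i
        rw [sub_add_cancel, sub_add_cancel] at hle
        have hlN := lamda_sq_pos hα1 hα2 hβ1 hβ2 N
        have hli := lamda_sq_pos hα1 hα2 hβ1 hβ2 i
        have hl := lamda_sq_mono (β := β) hα1 (Finset.mem_Ico.1 hi).1
        calc c i ^ 2 * Gnorm2 (α - β) β i
            ≤ c i ^ 2 * Gnorm2 (β - 1) (α - β - 1) (i + 1) :=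
              mul_le_mul_of_nonneg_left hle (sq_nonneg _)
          _ = 1 / lamda α β i ^ 2 * (fc (i + 1) ^ 2 / Gnorm2 (β - 1) (α - β - 1) (i + 1)) := by
              rw [hc, div_pow, mul_pow]
              field_simp
          _ ≤ _ := mul_le_mul_of_nonneg_right (one_div_le_one_div_of_le hlN hl) (by positivity)
    _ ≤ _ := by
        rw [← Finset.mul_sum]
        refine mul_le_mul_of_nonneg_left ?_ (one_div_nonneg.2 (sq_nonneg _))
        have h := sum_jacobi_coeff_sq_div_le ha hb hab hf (Finset.Ico (N + 1) (M + 1))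
        simp_rw [← hfc] at h
        rwa [← Finset.sum_Ico_add' (fun i => fc i ^ 2 / Gnorm2 (β - 1) (α - β - 1) i)] at h
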